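/- (Generalized fractional Gronwall inequality) Let a : [0,T] → ℝ be nonnegative and integrable, b > 0, α ∈ (0,1), and let φ : [0,T] → ℝ be nonnegative and integrable satisfying φ(t) ≤ a(t) + (b/Γ(α)) ∫₀ᵗ (t−s)^{α−1} φ(s) ds for almost all t ∈ [0,T]. Then φ(t) ≤ a(t) + ∫₀ᵗ b Γ(α)(t−s)^{α−1} E_{α,α}(bΓ(α)(t−s)^α) a(s) ds for almost all t ∈ [0,T], where E_{α,α}(x) = Σ_{k≥0} x^k/Γ(αk+α). -/

import Mathlib

open MeasureTheory intervalIntegral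

/-- Two-parameter Mittag--Leffler function `E_{α,α}(x) = Σ_{k≥0} x^k / Γ(αk+α)`. -/
noncomputable def mittagLeffler (α x : ℝ) : ℝ := ∑' k : ℕ, x ^ k / Real.Gamma (α * k + α)

lemma fg_one_le_Gamma {α : ℝ} (h0 : 0 < α) (h1 : α < 1) : 1 ≤ Real.Gamma α := by
  have hc := Real.convexOn_Gamma
  have hw : (0:ℝ) < 2 - α := by linarith
  have := hc.2 (Set.mem_Ioi.2 h0) (Set.mem_Ioi.2 (two_pos))
    (show 0 ≤ 1 / (2 - α) by positivity)
    (show 0 ≤ (1 - α) / (2 - α) by apply div_nonneg <;> linarith) (by field_simp; ring)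
  have e : (1 / (2 - α)) • α + ((1 - α) / (2 - α)) • (2:ℝ) = 1 := by
    simp only [smul_eq_mul]; field_simp; ring
  rw [e, Real.Gamma_one, Real.Gamma_two] at this
  simp only [smul_eq_mul] at this
  field_simp at this
  linarith

lemma fg_Gamma_lower {M x : ℝ} (hM : 0 < M) (hx : 1 ≤ x) :
    M ^ (x - 1) * Real.exp (-(M + 1)) ≤ Real.Gamma x := by
  rw [Real.Gamma_eq_integral (by linarith)]
  have hint := Real.GammaIntegral_convergent (s := x) (by linarith)
  calc M ^ (x - 1) * Real.exp (-(M + 1)) 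
      = ∫ t in Set.Ioc M (M+1), M ^ (x - 1) * Real.exp (-(M + 1)) := by simp
    _ ≤ ∫ t in Set.Ioc M (M+1), Real.exp (-t) * t ^ (x - 1) := by
        apply setIntegral_mono_on
        · exact integrableOn_const (by simp)
        · exact hint.mono_set (fun t ht => hM.trans ht.1)
        · exact measurableSet_Ioc
        · intro t ht
          rw [mul_comm]
          have : 0 ≤ x - 1 := by linarith
          have h1 := ht.1
          have h2 := ht.2
          gcongr
    _ ≤ ∫ t in Set.Ioi 0, Real.exp (-t) * t ^ (x - 1) := by
        apply setIntegral_mono_set hint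
        · filter_upwards [ae_restrict_mem measurableSet_Ioi] with t ht
          have : 0 < t := ht
          simp only [Pi.zero_apply]; positivity
        · have hsub : Set.Ioc M (M+1) ⊆ Set.Ioi 0 := fun t ht => hM.trans ht.1
          exact hsub.eventuallyLE

lemma fg_summable {α X : ℝ} (hα : 0 < α) (hX : 0 ≤ X) :
    Summable (fun k : ℕ => X ^ k / Real.Gamma (α * k + α)) := by
  set M : ℝ := (2 * X + 1) ^ (1 / α) with hMdef
  have hM : 0 < M := by positivity
  have hMα : M ^ α = 2 * X + 1 := by
    rw [hMdef, ← Real.rpow_mul (by positivity)]; field_simp; simp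
  have hg : Summable (fun k : ℕ => (Real.exp (M + 1) * M ^ (1 - α)) * (X / (2 * X + 1)) ^ k) := by
    apply Summable.mul_left
    apply summable_geometric_of_lt_one (by positivity)
    rw [div_lt_one (by positivity)]; linarith
  apply Summable.of_norm_bounded_eventually_nat hg
  obtain ⟨N, hN⟩ := exists_nat_ge (1 / α)
  filter_upwards [Filter.eventually_ge_atTop N] with k hk
  have hk' : (1:ℝ) ≤ α * k + α := by
    have : (N:ℝ) ≤ k := by exact_mod_cast hk
    have : 1 / α ≤ k := hN.trans this
    rw [div_le_iff₀ hα] at this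
    linarith
  have hG := fg_Gamma_lower hM hk'
  have hGpos : 0 < Real.Gamma (α * k + α) := Real.Gamma_pos_of_pos (by linarith)
  rw [Real.norm_of_nonneg (by positivity)]
  have e : M ^ (α * k + α - 1) = (2 * X + 1) ^ k * (M ^ (1 - α))⁻¹ := by
    rw [← hMα, ← Real.rpow_natCast (M ^ α), ← Real.rpow_mul hM.le, ← Real.rpow_neg hM.le,
      ← Real.rpow_add hM]; congr 1; ring
  rw [e, Real.exp_neg] at hG
  calc X ^ k / Real.Gamma (α * k + α) 
    ≤ X ^ k / ((2 * X + 1) ^ k * (M ^ (1 - α))⁻¹ * (Real.exp (M + 1))⁻¹) := by gcongr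
    _ = _ := by rw [div_pow]; field_simp

/-- Riemann–Liouville kernel -/
noncomputable def fgG (p u : ℝ) : ENNReal :=
  if 0 < u then ENNReal.ofReal (u ^ (p - 1) / Real.Gamma p) else 0

lemma fgG_meas (p : ℝ) : Measurable (fgG p) := by
  unfold fgG
  exact Measurable.ite measurableSet_Ioi (by fun_prop) (by fun_prop)

lemma fgG_conv {p q : ℝ} (hp : 0 < p) (hq : 0 < q) :
    lconvolution (fgG p) (fgG q) volume = fgG (p + q) := by
  ext t
  rw [lconvolution_def]
  have gp := Real.Gamma_pos_of_pos hp
  have gq := Real.Gamma_pos_of_pos hq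
  have gpq := Real.Gamma_pos_of_pos (add_pos hp hq)
  by_cases ht : 0 < t
  · have key : ∀ s, fgG p s * fgG q (-s + t) =
        ENNReal.ofReal (t ^ (p + q - 2) / Real.Gamma (p + q)) *
          ProbabilityTheory.betaPDF p q (t⁻¹ * s) := by
      intro s
      unfold fgG
      by_cases hs : 0 < s
      · by_cases hst : s < t
        · have h1 : 0 < -s + t := by linarith
          have h2 : 0 < t⁻¹ * s := by positivity
          have h3 : t⁻¹ * s < 1 := by rw [inv_mul_lt_iff₀ ht]; linarith
          rw [if_pos hs, if_pos h1, ProbabilityTheory.betaPDF_of_pos_lt_one h2 h3,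
            ← ENNReal.ofReal_mul (by positivity), ← ENNReal.ofReal_mul (by positivity)]
          congr 1
          have e1 : 1 - t⁻¹ * s = t⁻¹ * (-s + t) := by field_simp; ring
          have e2 : t ^ (p + q - 2) = t ^ (p - 1) * t ^ (q - 1) := by
            rw [← Real.rpow_add ht]; congr 1; ring
          rw [e1, Real.mul_rpow (by positivity) hs.le, Real.mul_rpow (by positivity) h1.le, e2,
            ProbabilityTheory.beta, Real.inv_rpow ht.le, Real.inv_rpow ht.le]
          field_simp
        · have h1 : ¬ 0 < -s + t := by linarith
          have h3 : 1 ≤ t⁻¹ * s := by rw [le_inv_mul_iff₀ ht]; linarith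
          rw [if_neg h1, ProbabilityTheory.betaPDF_eq_zero_of_one_le h3]; simp
      · have h3 : t⁻¹ * s ≤ 0 := by
          apply mul_nonpos_of_nonneg_of_nonpos (by positivity) (by linarith)
        rw [if_neg hs, ProbabilityTheory.betaPDF_eq_zero_of_nonpos h3]; simp
    simp_rw [key]
    have mb : Measurable (ProbabilityTheory.betaPDF p q) := by
      unfold ProbabilityTheory.betaPDF; fun_prop
    rw [lintegral_const_mul _ (by fun_prop)]
    have := lintegral_map (μ := volume) mb (measurable_const_mul t⁻¹)
    rw [← this, Real.map_volume_mul_left (by positivity), lintegral_smul_measure,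
      ProbabilityTheory.lintegral_betaPDF_eq_one hp hq]
    unfold fgG
    rw [if_pos ht, inv_inv, abs_of_pos ht, smul_eq_mul, mul_one, ← ENNReal.ofReal_mul (by positivity)]
    congr 1
    have : t ^ (p + q - 1) = t ^ (p + q - 2) * t := by
      rw [← Real.rpow_add_one ht.ne']; congr 1; ring
    rw [this]; ring
  · have : ∀ s, fgG p s * fgG q (-s + t) = 0 := by
      intro s
      unfold fgG
      by_cases hs : 0 < s
      · rw [if_neg (by linarith : ¬ 0 < -s + t)]; simp
      · rw [if_neg hs]; simp
    simp_rw [this]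
    simp [fgG, ht]

noncomputable def fgK (α B : ℝ) (n : ℕ) (u : ℝ) : ENNReal :=
  ENNReal.ofReal (B ^ (n + 1)) * fgG (α * n + α) u

lemma fgK_meas (α B : ℝ) (n : ℕ) : Measurable (fgK α B n) :=
  (fgG_meas _).const_mul _

lemma fgK_conv {α B : ℝ} (hα : 0 < α) (hB : 0 < B) (n : ℕ) :
    lconvolution (fgK α B 0) (fgK α B n) volume = fgK α B (n + 1) := by
  ext t
  have h := congrFun (fgG_conv (p := α) (q := α * n + α) hα (by positivity)) t
  rw [lconvolution_def] at h ⊢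
  have : ∀ s, fgK α B 0 s * fgK α B n (-s + t) = ENNReal.ofReal (B ^ (n + 1 + 1)) *
      (fgG α s * fgG (α * n + α) (-s + t)) := by
    intro s
    unfold fgK
    rw [pow_succ' B (n+1), ENNReal.ofReal_mul hB.le]
    simp
    ring
  simp_rw [this]
  have m1 := fgG_meas α
  have m2 := fgG_meas (α * n + α)
  rw [lintegral_const_mul _ (by fun_prop), h]
  unfold fgK
  congr 2
  push_cast; ring

lemma fgK_eq {α B u : ℝ} (hB : 0 < B) (hu : 0 < u) (n : ℕ) :
    fgK α B n u = ENNReal.ofReal (B * u ^ (α - 1) * ((B * u ^ α) ^ n / Real.Gamma (α * n + α))) := by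
  unfold fgK fgG
  rw [if_pos hu, ← ENNReal.ofReal_mul (by positivity)]
  congr 1
  have : u ^ (α * n + α - 1) = u ^ (α - 1) * (u ^ α) ^ n := by
    rw [← Real.rpow_natCast (u ^ α), ← Real.rpow_mul hu.le, ← Real.rpow_add hu]; congr 1; ring
  rw [this, mul_pow]; ring

noncomputable def fgR (α B : ℝ) (u : ℝ) : ENNReal := ∑' n, fgK α B n u

lemma fgR_meas (α B : ℝ) : Measurable (fgR α B) :=
  Measurable.tsum (fun n => fgK_meas α B n)

lemma fgR_eq {α B u : ℝ} (hα : 0 < α) (hB : 0 < B) (hu : 0 < u) :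
    fgR α B u = ENNReal.ofReal (B * u ^ (α - 1) * mittagLeffler α (B * u ^ α)) := by
  unfold fgR mittagLeffler
  simp_rw [fgK_eq hB hu]
  have hs := fg_summable hα (X := B * u ^ α) (by positivity)
  rw [← tsum_mul_left, ENNReal.ofReal_tsum_of_nonneg _ (hs.mul_left _)]
  intro n
  have := Real.Gamma_pos_of_pos (s := α * n + α) (by positivity)
  positivity

lemma fgR_zero {α B u : ℝ} (hu : ¬ 0 < u) : fgR α B u = 0 := by
  simp [fgR, fgK, fgG, hu]

lemma fgK_zero {α B u : ℝ} (n : ℕ) (hu : ¬ 0 < u) : fgK α B n u = 0 := by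
  simp [fgK, fgG, hu]

lemma fg_ML_mono {α x y : ℝ} (hα : 0 < α) (hx : 0 ≤ x) (hxy : x ≤ y) :
    mittagLeffler α x ≤ mittagLeffler α y := by
  unfold mittagLeffler
  refine Summable.tsum_le_tsum (fun n => ?_) (fg_summable hα hx) (fg_summable hα (hx.trans hxy))
  have := Real.Gamma_pos_of_pos (s := α * n + α) (by positivity)
  gcongr

lemma fg_ML_nonneg {α x : ℝ} (hα : 0 < α) (hx : 0 ≤ x) : 0 ≤ mittagLeffler α x := by
  unfold mittagLeffler
  refine tsum_nonneg (fun n => ?_)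
  have := Real.Gamma_pos_of_pos (s := α * n + α) (by positivity)
  positivity

lemma fgR_int {α B T : ℝ} (hα : 0 < α) (hB : 0 < B) (hT : 0 < T) :
    ∫⁻ u, (Set.Iic T).indicator (fgR α B) u < ⊤ := by
  have hI : IntegrableOn (fun u : ℝ => B * mittagLeffler α (B * T ^ α) * u ^ (α - 1)) (Set.Ioc 0 T) := by
    have := (intervalIntegral.intervalIntegrable_rpow' (a := 0) (b := T) (r := α - 1) (by linarith))
    rw [intervalIntegrable_iff_integrableOn_Ioc_of_le hT.le] at this
    exact this.const_mul _
  have hlt := hI.setLIntegral_lt_top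
  refine lt_of_le_of_lt ?_ hlt
  rw [← lintegral_indicator measurableSet_Ioc]
  apply lintegral_mono
  intro u
  by_cases hu : 0 < u
  · by_cases huT : u ≤ T
    · rw [Set.indicator_of_mem (show u ∈ Set.Iic T from huT),
        Set.indicator_of_mem (show u ∈ Set.Ioc 0 T from ⟨hu, huT⟩), fgR_eq hα hB hu]
      apply ENNReal.ofReal_le_ofReal
      rw [mul_right_comm]
      have := fg_ML_mono hα (x := B * u ^ α) (y := B * T ^ α) (by positivity) (by gcongr)
      gcongr
    · rw [Set.indicator_of_notMem (by simpa using huT)]; simp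
  · refine le_trans (Set.indicator_le_self _ _ _) ?_
    rw [fgR_zero hu]; simp

lemma fg_lint_conv {f g : ℝ → ENNReal} (hf : AEMeasurable f) (hg : Measurable g) :
    ∫⁻ t, lconvolution f g volume t = (∫⁻ s, f s) * ∫⁻ u, g u := by
  simp_rw [lconvolution_def]
  rw [lintegral_lintegral_swap]
  · have : ∀ s, ∫⁻ t, f s * g (-s + t) = f s * ∫⁻ u, g u := by
      intro s
      rw [lintegral_const_mul _ (by fun_prop), lintegral_add_left_eq_self]
    simp_rw [this]
    rw [lintegral_mul_const'' _ hf]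
  · have h1 : AEMeasurable (fun p : ℝ × ℝ => f p.2) (volume.prod volume) := hf.comp_snd
    have : Measurable (fun p : ℝ × ℝ => g (-p.2 + p.1)) := by fun_prop
    exact h1.mul this.aemeasurable

lemma fg_iter {α B : ℝ} (hα : 0 < α) (hB : 0 < B) {A F : ℝ → ENNReal}
    (hA : AEMeasurable A) (hF : AEMeasurable F)
    (h : ∀ᵐ t, F t ≤ A t + lconvolution F (fgK α B 0) volume t) (n : ℕ) :
    ∀ᵐ t, F t ≤ A t + (∑ j ∈ Finset.range n, lconvolution A (fgK α B j) volume t)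
      + lconvolution F (fgK α B n) volume t := by
  induction n with
  | zero => simpa using h
  | succ n ih =>
    filter_upwards [ih] with t ht
    refine ht.trans ?_
    rw [Finset.sum_range_succ, ← add_assoc, add_assoc (A t + _) _ (lconvolution F _ _ t)]
    refine add_le_add le_rfl ?_
    have m0 := fgK_meas α B 0
    have mn := fgK_meas α B n
    rw [← fgK_conv hα hB n, lconvolution_assoc₀ hF m0.aemeasurable mn.aemeasurable]
    rw [lconvolution_def, lconvolution_def, lconvolution_def, ← lintegral_add_left']
    · apply lintegral_mono_ae
      filter_upwards [h] with s hs
      rw [← add_mul]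
      gcongr
    · exact hA.mul (by fun_prop)

lemma fg_tail {α B T : ℝ} (hα : 0 < α) (hB : 0 < B) (hT : 0 < T) {F : ℝ → ENNReal}
    (hFm : AEMeasurable F)
    (hF : ∀ s, s ≤ 0 → F s = 0) (hFi : ∫⁻ s, F s < ⊤) {t : ℝ} (ht : t ≤ T) :
    Filter.Tendsto (fun n => lconvolution F (fgK α B n) volume t) Filter.atTop (nhds 0) := by
  have hs := fg_summable hα (X := B * T ^ α) (by positivity)
  have h1 := (hs.mul_left (B * T ^ (α - 1))).tendsto_atTop_zero
  have h2 := ENNReal.Tendsto.const_mul (ENNReal.tendsto_ofReal h1) (a := ∫⁻ s, F s) (Or.inr hFi.ne)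
  rw [ENNReal.ofReal_zero, mul_zero] at h2
  refine tendsto_of_tendsto_of_tendsto_of_le_of_le' tendsto_const_nhds h2 (by simp) ?_
  obtain ⟨N, hN⟩ := exists_nat_ge (1 / α)
  filter_upwards [Filter.eventually_ge_atTop N] with k hk
  have hk' : (1:ℝ) ≤ α * k + α := by
    have : (N:ℝ) ≤ k := by exact_mod_cast hk
    have : 1 / α ≤ k := hN.trans this
    rw [div_le_iff₀ hα] at this
    linarith
  rw [lconvolution_def, ← fgK_eq hB hT, ← lintegral_mul_const'' _ hFm]
  apply lintegral_mono
  intro s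
  by_cases hs : 0 < s
  · dsimp only
    gcongr
    by_cases hst : 0 < -s + t
    · unfold fgK fgG
      rw [if_pos hst, if_pos hT]
      have := Real.Gamma_pos_of_pos (s := α * k + α) (by positivity)
      have : 0 ≤ α * k + α - 1 := by linarith
      gcongr
      linarith
    · rw [fgK_zero _ hst]; simp
  · simp [hF s (not_lt.1 hs)]

theorem fractional_gronwall
    (T : ℝ) (hT : 0 < T) (α b : ℝ) (hα0 : 0 < α) (hα1 : α < 1) (hb : 0 < b)
    (a φ : ℝ → ℝ)
    (ha0 : ∀ t, 0 ≤ a t) (haInt : IntegrableOn a (Set.Icc 0 T))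
    (hφ0 : ∀ t, 0 ≤ φ t) (hφInt : IntegrableOn φ (Set.Icc 0 T))
    (h : ∀ᵐ t ∂(volume.restrict (Set.Icc (0:ℝ) T)),
      φ t ≤ a t + (b / Real.Gamma α) * ∫ s in (0:ℝ)..t, (t - s) ^ (α - 1) * φ s) :
    ∀ᵐ t ∂(volume.restrict (Set.Icc (0:ℝ) T)),
      φ t ≤ a t + ∫ s in (0:ℝ)..t,
        b * Real.Gamma α * (t - s) ^ (α - 1) *
          mittagLeffler α (b * Real.Gamma α * (t - s) ^ α) * a s := by
  have hΓ := fg_one_le_Gamma hα0 hα1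
  set B := b * Real.Gamma α with hBdef
  have hB : 0 < B := by positivity
  have hbB : b ≤ B := le_mul_of_one_le_right hb.le hΓ
  rw [← Measure.restrict_congr_set (Ioc_ae_eq_Icc), ae_restrict_iff' measurableSet_Ioc] at h ⊢
  replace haInt := haInt.mono_set Set.Ioc_subset_Icc_self
  replace hφInt := hφInt.mono_set Set.Ioc_subset_Icc_self
  set A : ℝ → ENNReal := (Set.Ioc 0 T).indicator (fun s => ENNReal.ofReal (a s)) with hAdef
  set F : ℝ → ENNReal := (Set.Ioc 0 T).indicator (fun s => ENNReal.ofReal (φ s)) with hFdef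
  have mA : AEMeasurable A :=
    (aemeasurable_indicator_iff measurableSet_Ioc).2 haInt.aemeasurable.ennreal_ofReal
  have mF : AEMeasurable F :=
    (aemeasurable_indicator_iff measurableSet_Ioc).2 hφInt.aemeasurable.ennreal_ofReal
  have iA : ∫⁻ s, A s < ⊤ := by
    rw [hAdef, lintegral_indicator measurableSet_Ioc]; exact haInt.setLIntegral_lt_top
  have iF : ∫⁻ s, F s < ⊤ := by
    rw [hFdef, lintegral_indicator measurableSet_Ioc]; exact hφInt.setLIntegral_lt_top
  have zA : ∀ s, s ≤ 0 → A s = 0 := fun s hs =>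
    Set.indicator_of_notMem (fun h => absurd h.1 (not_lt.2 hs)) _
  have zF : ∀ s, s ≤ 0 → F s = 0 := fun s hs =>
    Set.indicator_of_notMem (fun h => absurd h.1 (not_lt.2 hs)) _
  have h0 : ∀ᵐ t, F t ≤ A t + lconvolution F (fgK α B 0) volume t := by
    filter_upwards [h] with t ht
    by_cases htT : t ∈ Set.Ioc 0 T
    · rw [hFdef, hAdef, Set.indicator_of_mem htT, Set.indicator_of_mem htT]
      refine (ENNReal.ofReal_le_ofReal (ht htT)).trans ?_
      refine ENNReal.ofReal_add_le.trans ?_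
      gcongr
      rw [intervalIntegral.integral_of_le htT.1.le, integral_Ioc_eq_integral_Ioo,
        ← MeasureTheory.integral_const_mul]
      refine (Real.ofReal_le_enorm _).trans ?_
      refine (enorm_integral_le_lintegral_enorm _).trans ?_
      rw [lconvolution_def, ← lintegral_indicator measurableSet_Ioo]
      apply lintegral_mono
      intro s
      by_cases hs : s ∈ Set.Ioo 0 t
      · have hst : 0 < -s + t := by linarith [hs.2]
        dsimp only
        rw [Set.indicator_of_mem hs, Set.indicator_of_mem (show s ∈ Set.Ioc 0 T from ⟨hs.1, hs.2.le.trans htT.2⟩),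
          fgK_eq hB hst, ← ENNReal.ofReal_mul (hφ0 s)]
        have hst' : 0 < t - s := by linarith
        have := hφ0 s
        rw [Real.enorm_of_nonneg (by positivity)]
        apply ENNReal.ofReal_le_ofReal
        rw [show -s + t = t - s by ring]
        simp only [pow_zero, Nat.cast_zero, mul_zero, zero_add]
        calc b / Real.Gamma α * ((t - s) ^ (α - 1) * φ s) ≤ B / Real.Gamma α * ((t - s) ^ (α - 1) * φ s) := by gcongr
          _ = _ := by ring
      · rw [Set.indicator_of_notMem hs]; simp
    · rw [hFdef, Set.indicator_of_notMem htT]; simp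
  have hall := ae_all_iff.2 (fun n => fg_iter hα0 hB mA mF h0 n)
  have mR := fgR_meas α B
  have mRi : Measurable ((Set.Iic T).indicator (fgR α B)) := mR.indicator measurableSet_Iic
  have hfin : ∀ᵐ t, lconvolution A ((Set.Iic T).indicator (fgR α B)) volume t < ⊤ := by
    apply ae_lt_top'
    · exact aemeasurable_lconvolution mA mRi.aemeasurable
    · rw [fg_lint_conv mA mRi]
      exact (ENNReal.mul_lt_top iA (fgR_int hα0 hB hT)).ne
  filter_upwards [hall, hfin] with t ht hft htT
  have hconv : lconvolution A (fgR α B) volume t < ⊤ := by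
    refine lt_of_le_of_lt ?_ hft
    rw [lconvolution_def, lconvolution_def]
    apply lintegral_mono
    intro s
    by_cases hs : 0 < s
    · dsimp only
      rw [Set.indicator_of_mem (show -s + t ∈ Set.Iic T by simp only [Set.mem_Iic]; linarith [htT.2])]
    · simp [zA s (not_lt.1 hs)]
  have hsum : ∑' j, lconvolution A (fgK α B j) volume t = lconvolution A (fgR α B) volume t := by
    simp_rw [lconvolution_def, fgR, ← ENNReal.tsum_mul_left]
    rw [lintegral_tsum]
    intro j
    have := fgK_meas α B j
    exact mA.mul (by fun_prop)
  have hmain : F t ≤ A t + lconvolution A (fgR α B) volume t := by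
    have ht0 := (fg_tail hα0 hB hT mF zF iF htT.2).const_add (A t + lconvolution A (fgR α B) volume t)
    rw [add_zero] at ht0
    refine ge_of_tendsto' ht0 (fun n => (ht n).trans ?_)
    gcongr
    rw [← hsum]
    exact ENNReal.sum_le_tsum _
  have hpt : ∀ s, A s * fgR α B (-s + t) = (Set.Ioo 0 t).indicator (fun s => ENNReal.ofReal
      (B * (t - s) ^ (α - 1) * mittagLeffler α (B * (t - s) ^ α) * a s)) s := by
    intro s
    by_cases hs : s ∈ Set.Ioo 0 t
    · have hst : 0 < -s + t := by linarith [hs.2]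
      rw [Set.indicator_of_mem hs, hAdef, Set.indicator_of_mem (show s ∈ Set.Ioc 0 T from ⟨hs.1, hs.2.le.trans htT.2⟩),
        fgR_eq hα0 hB hst, ← ENNReal.ofReal_mul (ha0 s), mul_comm, show -s + t = t - s by ring]
    · rw [Set.indicator_of_notMem hs]
      by_cases hs0 : 0 < s
      · rw [fgR_zero, mul_zero]
        intro hc
        exact hs ⟨hs0, by linarith⟩
      · rw [zA s (not_lt.1 hs0), zero_mul]
  have hpos : ∀ s ∈ Set.Ioo 0 t, 0 ≤ B * (t - s) ^ (α - 1) * mittagLeffler α (B * (t - s) ^ α) * a s := by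
    intro s hs
    have : 0 < t - s := by linarith [hs.2]
    have := ha0 s
    have := fg_ML_nonneg hα0 (x := B * (t - s) ^ α) (by positivity)
    positivity
  have hI : ∫ s in (0:ℝ)..t, B * (t - s) ^ (α - 1) * mittagLeffler α (B * (t - s) ^ α) * a s
      = (lconvolution A (fgR α B) volume t).toReal := by
    have hm : AEMeasurable (fun s => A s * fgR α B (-s + t)) := mA.mul (by fun_prop)
    rw [lconvolution_def] at hconv ⊢
    rw [← integral_toReal hm (ae_lt_top' hm hconv.ne),
      intervalIntegral.integral_of_le htT.1.le, integral_Ioc_eq_integral_Ioo,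
      ← MeasureTheory.integral_indicator measurableSet_Ioo]
    congr 1
    ext s
    rw [hpt]
    by_cases hs : s ∈ Set.Ioo 0 t
    · rw [Set.indicator_of_mem hs, Set.indicator_of_mem hs, ENNReal.toReal_ofReal (hpos s hs)]
    · rw [Set.indicator_of_notMem hs, Set.indicator_of_notMem hs]; simp
  rw [hI]
  rw [hFdef, hAdef, Set.indicator_of_mem htT, Set.indicator_of_mem htT, ← hAdef,
    ← ENNReal.ofReal_toReal hconv.ne, ← ENNReal.ofReal_add (ha0 t) ENNReal.toReal_nonneg] at hmain
  exact (ENNReal.ofReal_le_ofReal_iff (add_nonneg (ha0 t) ENNReal.toReal_nonneg)).1 hmain
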